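/- arXiv:math/0306248 — 2 statements merged into one kernel-verified Lean document; each statement's English description precedes it below -/
import Mathlib

section
/- Let β ∈ (0, 1/2^{|S|}) and ε ∈ (0, β(1−β)/(L·|S|⁴)). Let q be an irreducible transition matrix on S with stationary distribution μ, and let q̂ be a transition matrix that is (ε,β)-close to q. Let C be a nonempty proper subset of S. Then for every g ∈ G^β(C) (β-maximal under q), μ_s·q(g(s)|s) ≥ ε·ζ_q for every s ∈ C; and for every g ∈ Ĝ^β(C) (β-maximal under q̂), μ_s·q̂(g(s)|s) ≥ ε·ζ_q for every s ∈ C. -/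
open Finset

namespace PerturbedMC

variable {S : Type*} [Fintype S] [DecidableEq S]

/-- `q` is a (row-stochastic) transition matrix on `S`: `q s t` is the probability of moving
from `s` to `t`. -/
def IsTransition (q : Matrix S S ℝ) : Prop :=
  (∀ s t, 0 ≤ q s t) ∧ ∀ s, ∑ t, q s t = 1

/-- `q` is irreducible. -/
def IsIrreducible (q : Matrix S S ℝ) : Prop :=
  ∀ s t, ∃ n : ℕ, 1 ≤ n ∧ 0 < (q ^ n) s t

/-- `μ` is a stationary distribution of `q`. -/
def IsStationary (q : Matrix S S ℝ) (μ : S → ℝ) : Prop :=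
  (∀ s, 0 ≤ μ s) ∧ (∑ s, μ s = 1) ∧ ∀ t, ∑ s, μ s * q s t = μ t

/-- The combinatorial constant `L = ∑_{n=1}^{|S|-1} C(|S|,n) · n^{|S|}`. -/
def Lconst (S : Type*) [Fintype S] : ℕ :=
  ∑ n ∈ Finset.Ico 1 (Fintype.card S), (Fintype.card S).choose n * n ^ Fintype.card S

/-- `ζ_q`: the minimal stationary outflow over nonempty proper subsets of `S`. -/
noncomputable def zeta (q : Matrix S S ℝ) (μ : S → ℝ) : ℝ :=
  sInf {x : ℝ | ∃ C : Finset S, C.Nonempty ∧ C ≠ Finset.univ ∧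
    x = ∑ s ∈ C, μ s * ∑ t ∈ Cᶜ, q s t}

/-- `ζ_q^1`: the minimal stationary outflow over nonempty proper subsets of `S₁`. -/
noncomputable def zeta1 (q : Matrix S S ℝ) (μ : S → ℝ) (S1 : Finset S) : ℝ :=
  sInf {x : ℝ | ∃ C : Finset S, C.Nonempty ∧ C ⊂ S1 ∧
    x = ∑ s ∈ C, μ s * ∑ t ∈ Cᶜ, q s t}

/-- `q̂` is `(ε,β)`-close to `q`, relative to the threshold `z` (`z = ζ_q` or `z = ζ_q^1`):
`|q̂(t|s) − q(t|s)| ≤ β·q(t|s)` whenever `μ_s q(t|s) ≥ ε·z` or `μ_s q̂(t|s) ≥ ε·z`. -/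
def IsClose (q qh : Matrix S S ℝ) (μ : S → ℝ) (z ε β : ℝ) : Prop :=
  ∀ s t, (ε * z ≤ μ s * q s t ∨ ε * z ≤ μ s * qh s t) → |qh s t - q s t| ≤ β * q s t

/-- The substochastic `C × C` restriction `q_C` of `q`. -/
def subMat (q : Matrix S S ℝ) (C : Finset S) : Matrix S S ℝ :=
  fun u v => if u ∈ C ∧ v ∈ C then q u v else 0

/-- The exit distribution `Q_{s,q}(t|C) = Σ_{n≥0} Σ_{u∈C} (q_C^n)(u|s)·q(t|u)`. -/
noncomputable def exitProb (q : Matrix S S ℝ) (C : Finset S) (s t : S) : ℝ :=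
  ∑' n : ℕ, ∑ u ∈ C, ((subMat q C ^ n : Matrix S S ℝ) s u) * q u t

/-- The expected exit time `E_{s,q}[T_{C̄}] = Σ_{n≥0} Σ_{u∈C} (q_C^n)(u|s) ∈ [0,∞]`. -/
noncomputable def expExit (q : Matrix S S ℝ) (C : Finset S) (s : S) : ENNReal :=
  ∑' n : ℕ, ENNReal.ofReal (∑ u ∈ C, (subMat q C ^ n : Matrix S S ℝ) s u)

/-- `g` has a cycle within `C`. -/
def HasCycle (C : Finset S) (g : S → S) : Prop :=
  ∃ (k : ℕ) (f : ℕ → S), 0 < k ∧ f k = f 0 ∧ (∀ i < k, f i ∈ C) ∧ ∀ i < k, g (f i) = f (i + 1)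

/-- `g` is a `C`-graph (the values of `g` outside `C` are irrelevant). -/
def IsCGraph (C : Finset S) (g : S → S) : Prop := ¬ HasCycle C g

/-- `s` leads to `t` along `g`: `t` is the first state outside `C` on the `g`-orbit of `s`. -/
def LeadsTo (C : Finset S) (g : S → S) (s t : S) : Prop :=
  ∃ n : ℕ, g^[n] s = t ∧ t ∉ C ∧ ∀ m < n, g^[m] s ∈ C

/-- The weight `p(g) = Π_{s∈C} q(g(s)|s)` of a `C`-graph under `q`. -/
def wt (q : Matrix S S ℝ) (C : Finset S) (g : S → S) : ℝ := ∏ s ∈ C, q s (g s)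

/-- `G(C)`: the canonical representatives of `C`-graphs, namely the maps `S → S` that are
`C`-graphs and are the identity outside `C`. -/
noncomputable def Gset (C : Finset S) : Finset (S → S) :=
  @Finset.filter _ (fun g => IsCGraph C g ∧ ∀ s ∉ C, g s = s) (Classical.decPred _) Finset.univ

/-- `G_{s,t}(C)`: the `C`-graphs along which `s` leads to `t`. -/
noncomputable def GsetLead (C : Finset S) (s t : S) : Finset (S → S) :=
  @Finset.filter _ (fun g => LeadsTo C g s t) (Classical.decPred _) (Gset C)

/-- `g` is an `η`-maximal `C`-graph under `q`: `p(g) ≥ η · max_{g' ∈ G(C)} p(g')`. -/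
def IsMaximal (q : Matrix S S ℝ) (C : Finset S) (η : ℝ) (g : S → S) : Prop :=
  IsCGraph C g ∧ ∀ g', IsCGraph C g' → η * wt q C g' ≤ wt q C g

/-- `H = G^β(C) ∪ Ĝ^β(C)` as a finset of canonical representatives. -/
noncomputable def Hset (q qh : Matrix S S ℝ) (C : Finset S) (β : ℝ) : Finset (S → S) :=
  @Finset.filter _ (fun g => IsMaximal q C β g ∨ IsMaximal qh C β g)
    (Classical.decPred _) (Gset C)

/-- The mixing hypothesis with parameter `a` on `S₁`: for all `s,t ∈ S₁`, the probability
that the chain started at `s`, from its first step onward, reaches `t` before reaching any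
state of `S \ S₁`, is at least `a`. -/
def Mixing (q : Matrix S S ℝ) (S1 : Finset S) (a : ℝ) : Prop :=
  ∀ s ∈ S1, ∀ t ∈ S1,
    a ≤ q s t + ∑ u ∈ S1.erase t, q s u * exitProb q (S1.erase t) u t

/-- `R` is a recurrent class for `q`. -/
def IsRecClass (q : Matrix S S ℝ) (R : Finset S) : Prop :=
  (∀ s ∈ R, ∑ t ∈ Rᶜ, q s t = 0) ∧
    ∀ s ∈ R, ∀ t ∈ R, ∃ n : ℕ, 1 ≤ n ∧ 0 < (q ^ n) s t

omit [Fintype S] [DecidableEq S] in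
lemma iterate_eq_of_eqOn_orbit {k k' : S → S} {x : S} {n : ℕ}
    (h : ∀ m < n, k' (k^[m] x) = k (k^[m] x)) : k'^[n] x = k^[n] x := by
  induction n with
  | zero => rfl
  | succ n ih =>
    rw [Function.iterate_succ_apply', Function.iterate_succ_apply',
      ih fun m hm => h m (by omega), h n (by omega)]

omit [Fintype S] in
lemma iterate_update_of_avoid {k : S → S} {x u v : S} {n : ℕ} (h : ∀ m < n, k^[m] x ≠ u) :
    (Function.update k u v)^[n] x = k^[n] x :=
  iterate_eq_of_eqOn_orbit fun m hm => Function.update_of_ne (h m hm) _ _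

omit [DecidableEq S] in
/-- A map is a `C`-graph iff each of its orbits leaves `C`. -/
lemma isCGraph_iff_forall_exists_notMem {C : Finset S} {g : S → S} :
    IsCGraph C g ↔ ∀ x, ∃ n, g^[n] x ∉ C := by
  constructor
  · intro h x
    by_contra! hx
    obtain ⟨m, n, hmn, he⟩ := Finite.exists_ne_map_eq_of_infinite fun n : ℕ => g^[n] x
    wlog hlt : m < n generalizing m n
    · exact this n m hmn.symm he.symm (by omega)
    refine h ⟨n - m, fun i => g^[m + i] x, by omega, ?_, fun i _ => hx _, fun i _ => ?_⟩
    · simpa [Nat.add_sub_cancel' hlt.le] using he.symm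
    · exact (Function.iterate_succ_apply' g (m + i) x).symm
  · rintro h ⟨k, f, hk, hf, hC, hg⟩
    have horbit : ∀ n, ∃ i < k, g^[n] (f 0) = f i := by
      intro n
      induction n with
      | zero => exact ⟨0, hk, rfl⟩
      | succ n ih =>
        obtain ⟨i, hi, he⟩ := ih
        rw [Function.iterate_succ_apply', he, hg i hi]
        rcases Nat.lt_or_ge (i + 1) k with hik | hik
        · exact ⟨i + 1, hik, rfl⟩
        · exact ⟨0, hk, by rw [← hf]; congr 1; omega⟩
    obtain ⟨n, hn⟩ := h (f 0)
    obtain ⟨i, hi, he⟩ := horbit n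
    exact hn (he ▸ hC i hi)

omit [Fintype S] [DecidableEq S] in
lemma IsCGraph.of_subset_of_eqOn {B C : Finset S} {g g' : S → S} (hg : IsCGraph C g)
    (hBC : B ⊆ C) (h : ∀ s ∈ B, g' s = g s) : IsCGraph B g' := by
  rintro ⟨k, f, hk, hf, hB, hs⟩
  exact hg ⟨k, f, hk, hf, fun i hi => hBC (hB i hi),
    fun i hi => by rw [← h _ (hB i hi), hs i hi]⟩

/-- Redirecting `u` to a state whose orbit avoids `u` creates no cycle. -/
lemma IsCGraph.update {B : Finset S} {k : S → S} {u v : S} (hk : IsCGraph B k)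
    (hv : ∀ n, k^[n] v ≠ u) : IsCGraph (insert u B) (Function.update k u v) := by
  rw [isCGraph_iff_forall_exists_notMem] at hk ⊢
  have avoid : ∀ x, (∀ n, k^[n] x ≠ u) → ∃ n, (Function.update k u v)^[n] x ∉ insert u B := by
    intro x hx
    obtain ⟨n, hn⟩ := hk x
    refine ⟨n, ?_⟩
    rw [iterate_update_of_avoid fun m _ => hx m]
    simp [hx n, hn]
  intro x
  by_cases hx : ∃ n, k^[n] x = u
  · classical
    obtain ⟨n, hn⟩ := avoid v hv
    refine ⟨n + 1 + Nat.find hx, ?_⟩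
    rw [Function.iterate_add_apply, iterate_update_of_avoid fun m hm => Nat.find_min hx hm,
      Nat.find_spec hx, Function.iterate_succ_apply, Function.update_self]
    exact hn
  · exact avoid x (not_exists.mp hx)

omit [Fintype S] [DecidableEq S] in
lemma iterate_fixed_of_notMem {B : Finset S} {k : S → S} (hfix : ∀ s ∉ B, k s = s) {s : S}
    (hs : s ∉ B) (n : ℕ) : k^[n] s = s :=
  Function.iterate_fixed (hfix s hs) n

omit [DecidableEq S] in
/-- The orbit of the image of a state of `B` under a `B`-graph never returns to that state. -/
lemma IsCGraph.iterate_apply_ne {B : Finset S} {k : S → S} (hk : IsCGraph B k)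
    (hfix : ∀ s ∉ B, k s = s) {u : S} (hu : u ∈ B) (n : ℕ) : k^[n] (k u) ≠ u := by
  intro h
  obtain ⟨j, hj⟩ := isCGraph_iff_forall_exists_notMem.mp hk u
  have hper : (k^[n + 1])^[j] u = u := Function.iterate_fixed h j
  rw [← Function.iterate_mul, show (n + 1) * j = n * j + j by ring,
    Function.iterate_add_apply, iterate_fixed_of_notMem hfix hj] at hper
  rw [hper] at hj
  exact hj hu

lemma mem_Gset {B : Finset S} {k : S → S} :
    k ∈ Gset B ↔ IsCGraph B k ∧ ∀ s ∉ B, k s = s := by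
  simp [Gset]

lemma card_Gset_le (B : Finset S) : #(Gset B) ≤ Fintype.card S ^ #B := by
  have hsub : Gset B ⊆ Fintype.piFinset fun s => if s ∈ B then univ else {s} := by
    intro k hk
    rw [Fintype.mem_piFinset]
    intro s
    by_cases hs : s ∈ B
    · simp [hs]
    · simp [hs, (mem_Gset.mp hk).2 s hs]
  refine (card_le_card hsub).trans (le_of_eq ?_)
  simp [Fintype.card_piFinset, apply_ite Finset.card]

omit [Fintype S] [DecidableEq S] in
lemma wt_congr (w : Matrix S S ℝ) {C : Finset S} {g g' : S → S} (h : ∀ s ∈ C, g s = g' s) :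
    wt w C g = wt w C g' :=
  Finset.prod_congr rfl fun s hs => by rw [h s hs]

omit [Fintype S] [DecidableEq S] in
lemma wt_nonneg {w : Matrix S S ℝ} (hw : ∀ s t, 0 ≤ w s t) (C : Finset S) (g : S → S) :
    0 ≤ wt w C g :=
  Finset.prod_nonneg fun _ _ => hw _ _

omit [Fintype S] in
lemma mul_wt_erase (w : Matrix S S ℝ) {C : Finset S} {u : S} (hu : u ∈ C) (k : S → S) :
    w u (k u) * wt w (C.erase u) k = wt w C k :=
  Finset.mul_prod_erase C (fun s => w s (k s)) hu

omit [Fintype S] in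
lemma wt_update (w : Matrix S S ℝ) {C : Finset S} {u : S} (hu : u ∈ C) (k : S → S) (v : S) :
    wt w C (Function.update k u v) = w u v * wt w (C.erase u) k := by
  rw [← mul_wt_erase w hu, Function.update_self]
  congr 1
  exact wt_congr w fun s hs => Function.update_of_ne (Finset.ne_of_mem_erase hs) _ _

open Classical in
/-- The total weight of the `B`-graphs along which `x` leads to `r`. -/
noncomputable def leadWeight (w : Matrix S S ℝ) (B : Finset S) (r x : S) : ℝ :=
  ∑ k ∈ Gset B with ∃ n, k^[n] x = r, wt w B k

lemma leadWeight_eq_zero (w : Matrix S S ℝ) {B : Finset S} {r x : S} (hx : x ∉ B) (hxr : x ≠ r) :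
    leadWeight w B r x = 0 := by
  classical
  rw [leadWeight, Finset.filter_false_of_mem, Finset.sum_empty]
  rintro k hk ⟨n, hn⟩
  rw [iterate_fixed_of_notMem (mem_Gset.mp hk).2 hx] at hn
  exact hxr hn

lemma wt_le_leadWeight {w : Matrix S S ℝ} (hw : ∀ s t, 0 ≤ w s t) {B : Finset S} {r x : S}
    {k : S → S} (hk : k ∈ Gset B) (hx : ∃ n, k^[n] x = r) : wt w B k ≤ leadWeight w B r x := by
  classical
  exact Finset.single_le_sum (f := fun k => wt w B k) (fun _ _ => wt_nonneg hw _ _)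
    (Finset.mem_filter.mpr ⟨hk, hx⟩)

/-- `leadWeight` is subharmonic on `B` for the weights `w`. -/
lemma sum_mul_leadWeight_le {w : Matrix S S ℝ} (hw : ∀ s t, 0 ≤ w s t) {B : Finset S} {r u : S}
    (hr : r ∉ B) (hu : u ∈ B) :
    ∑ v, w u v * leadWeight w B r u ≤ ∑ v, w u v * leadWeight w B r v := by
  classical
  set f : S × (S → S) → ℝ := fun p => w u p.1 * wt w B p.2 with hf
  set from_u := (univ ×ˢ Gset B).filter fun p : S × (S → S) => ∃ n, p.2^[n] u = r with hA
  set from_v := (univ ×ˢ Gset B).filter fun p : S × (S → S) => ∃ n, p.2^[n] p.1 = r with hB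
  have expand : ∀ P : S → (S → S) → Prop,
      ∑ v, w u v * ∑ k ∈ Gset B with P v k, wt w B k =
        ∑ p ∈ (univ ×ˢ Gset B).filter fun p : S × (S → S) => P p.1 p.2, f p := by
    intro P
    rw [Finset.sum_filter, Finset.sum_product]
    refine Finset.sum_congr rfl fun v _ => ?_
    rw [Finset.sum_filter, Finset.mul_sum]
    refine Finset.sum_congr rfl fun k _ => ?_
    split_ifs <;> simp [hf]
  have hleft : ∑ v, w u v * leadWeight w B r u = ∑ p ∈ from_u, f p :=
    expand fun _ k => ∃ n, k^[n] u = r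
  have hright : ∑ v, w u v * leadWeight w B r v = ∑ p ∈ from_v, f p :=
    expand fun v k => ∃ n, k^[n] v = r
  rw [hleft, hright, ← Finset.sum_sdiff_le_sum_sdiff]
  let ψ : S × (S → S) → S × (S → S) := fun p => (p.2 u, Function.update p.2 u p.1)
  have hψ : Function.Involutive ψ := by
    rintro ⟨v, k⟩
    simp [ψ]
  have hmaps : ∀ p ∈ from_u \ from_v, ψ p ∈ from_v \ from_u := by
    rintro ⟨v, k⟩ hp
    simp only [hA, hB, Finset.mem_sdiff, Finset.mem_filter, Finset.mem_product, Finset.mem_univ,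
      true_and, not_and, ψ] at hp ⊢
    obtain ⟨⟨hk, n, hn⟩, hv⟩ := hp
    replace hv := not_exists.mp (hv hk)
    obtain ⟨hkB, hfix⟩ := mem_Gset.mp hk
    have hru : r ≠ u := fun h => hr (h ▸ hu)
    have hvu : ∀ m, k^[m] v ≠ u := fun m hm =>
      hv (n + m) (by rw [Function.iterate_add_apply, hm, hn])
    have hku := hkB.iterate_apply_ne hfix hu
    have hnew : Function.update k u v ∈ Gset B := by
      refine mem_Gset.mpr ⟨by simpa [hu] using hkB.update hvu, fun s hs => ?_⟩
      rw [Function.update_of_ne (by rintro rfl; exact hs hu), hfix s hs]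
    refine ⟨⟨hnew, ?_⟩, fun _ => ?_⟩
    · cases n with
      | zero => exact absurd hn.symm hru
      | succ n =>
        exact ⟨n, by rw [iterate_update_of_avoid fun m _ => hku m]; exact hn⟩
    · rintro ⟨m, hm⟩
      cases m with
      | zero => exact hru hm.symm
      | succ m =>
        rw [Function.iterate_succ_apply, Function.update_self,
          iterate_update_of_avoid fun m _ => hvu m] at hm
        exact hv m hm
  have hfψ : ∀ p, f (ψ p) = f p := by
    rintro ⟨v, k⟩
    simp only [hf, ψ]
    rw [wt_update w hu, ← mul_wt_erase w hu k]
    ring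
  calc ∑ p ∈ from_u \ from_v, f p = ∑ p ∈ (from_u \ from_v).image ψ, f p := by
        rw [Finset.sum_image hψ.injective.injOn]
        simp [hfψ]
    _ ≤ ∑ p ∈ from_v \ from_u, f p :=
        Finset.sum_le_sum_of_subset_of_nonneg (Finset.image_subset_iff.mpr hmaps)
          fun p _ _ => mul_nonneg (hw _ _) (wt_nonneg hw _ _)

/-- At the root, the defect of harmonicity of `leadWeight` is at most the number of pairs of a
target and a graph, times any bound on the weights of the graphs obtained from such pairs. -/
lemma sum_mul_leadWeight_root_le {w : Matrix S S ℝ} {D : Finset S} {r : S}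
    (hr : r ∈ D) {M : ℝ} (hM0 : 0 ≤ M) (hM : ∀ k, IsCGraph D k → wt w D k ≤ M) :
    ∑ v, w r v * leadWeight w (D.erase r) r r ≤
      ∑ v, w r v * leadWeight w (D.erase r) r v + (Fintype.card S : ℝ) ^ #D * M := by
  classical
  have hterm : ∀ v, w r v * leadWeight w (D.erase r) r r ≤
      w r v * leadWeight w (D.erase r) r v + #(Gset (D.erase r)) * M := by
    intro v
    rw [leadWeight, leadWeight, Finset.filter_true_of_mem fun k _ => ⟨0, rfl⟩,
      ← Finset.sum_filter_add_sum_filter_not (Gset (D.erase r)) fun k => ∃ n, k^[n] v = r,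
      mul_add, Finset.mul_sum (Finset.filter (fun k => ¬ _) _)]
    gcongr
    refine (Finset.sum_le_card_nsmul _ _ M fun k hk => ?_).trans ?_
    · rw [Finset.mem_filter] at hk
      rw [← wt_update w hr]
      refine hM _ ?_
      simpa [Finset.insert_erase hr] using
        (mem_Gset.mp hk.1).1.update (not_exists.mp hk.2)
    · rw [nsmul_eq_mul]
      gcongr
      exact Finset.filter_subset _ _
  refine (Finset.sum_le_sum fun v _ => hterm v).trans ?_
  rw [Finset.sum_add_distrib, Finset.sum_const, Finset.card_univ, nsmul_eq_mul, ← mul_assoc]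
  gcongr
  have h := card_Gset_le (D.erase r)
  calc (Fintype.card S : ℝ) * #(Gset (D.erase r))
      ≤ Fintype.card S * (Fintype.card S : ℝ) ^ #(D.erase r) := by
        gcongr
        exact_mod_cast h
    _ = (Fintype.card S : ℝ) ^ #D := by
        rw [← Finset.card_erase_add_one hr, pow_succ']

/-- For balanced weights, the inflow into `D` weighted by a function vanishing off `D` equals its
total defect of harmonicity on `D`. -/
lemma sum_mul_inflow_eq {w : Matrix S S ℝ} (hbal : ∀ s, ∑ t, w s t = ∑ t, w t s) {D : Finset S}
    {F : S → ℝ} (hF : ∀ s ∉ D, F s = 0) :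
    ∑ u ∈ D, F u * ∑ v ∈ Dᶜ, w v u =
      ∑ u ∈ D, (∑ v, w u v * F u - ∑ v, w u v * F v) := by
  have hsplit : ∀ u, ∑ v ∈ Dᶜ, w v u = ∑ v, w u v - ∑ v ∈ D, w v u := fun u => by
    rw [hbal u, ← Finset.sum_add_sum_compl D]; ring
  have hsupp : ∀ u, ∑ v, w u v * F v = ∑ v ∈ D, w u v * F v := fun u =>
    (Finset.sum_subset (Finset.subset_univ D) fun v _ hv => by rw [hF v hv, mul_zero]).symm
  simp only [hsplit, hsupp, mul_sub, Finset.sum_sub_distrib, ← Finset.sum_mul]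
  congr 1
  · exact Finset.sum_congr rfl fun u _ => mul_comm _ _
  · simp only [Finset.mul_sum]
    rw [Finset.sum_comm]
    exact Finset.sum_congr rfl fun _ _ => Finset.sum_congr rfl fun _ _ => mul_comm _ _

lemma inflow_eq_outflow {w : Matrix S S ℝ} (hbal : ∀ s, ∑ t, w s t = ∑ t, w t s) (D : Finset S) :
    ∑ u ∈ D, ∑ v ∈ Dᶜ, w v u = ∑ u ∈ D, ∑ v ∈ Dᶜ, w u v := by
  have h : ∑ u ∈ D, ∑ t, w u t = ∑ u ∈ D, ∑ t, w t u := Finset.sum_congr rfl fun u _ => hbal u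
  simp only [← Finset.sum_add_sum_compl D, Finset.sum_add_distrib] at h
  rw [Finset.sum_comm (s := D) (t := D)] at h
  linarith

/-- A maximal `C`-graph restricts to a maximal `D`-graph when no state of `C \ D` is mapped
into `D`. -/
lemma IsMaximal.restrict {w : Matrix S S ℝ} (hw : ∀ s t, 0 ≤ w s t) {C D : Finset S} {b : ℝ}
    {g : S → S} (hg : IsMaximal w C b g) (hpos : 0 < wt w C g) (hDC : D ⊆ C)
    (hD : ∀ x, g x ∈ D → x ∈ D) : IsMaximal w D b g := by
  classical
  refine ⟨hg.1.of_subset_of_eqOn hDC fun _ _ => rfl, fun k hk => ?_⟩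
  set k' : S → S := fun x => if x ∈ D then k x else g x with hk'
  have hgraph : IsCGraph C k' := by
    rw [isCGraph_iff_forall_exists_notMem]
    intro x
    have hx := isCGraph_iff_forall_exists_notMem.mp hk x
    obtain ⟨m, hm⟩ := isCGraph_iff_forall_exists_notMem.mp hg.1 (k^[Nat.find hx] x)
    have hout : ∀ j, g^[j] (k^[Nat.find hx] x) ∉ D := by
      intro j
      induction j with
      | zero => exact Nat.find_spec hx
      | succ j ih =>
        rw [Function.iterate_succ_apply']
        exact fun h => ih (hD _ h)
    refine ⟨m + Nat.find hx, ?_⟩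
    rw [Function.iterate_add_apply, iterate_eq_of_eqOn_orbit (k := k) (n := Nat.find hx),
      iterate_eq_of_eqOn_orbit (k := g)]
    · exact hm
    · exact fun j _ => if_neg (hout j)
    · exact fun j hj => if_pos (not_not.mp (Nat.find_min hx hj))
  have hsplit : ∀ h : S → S, wt w C h = wt w (C \ D) h * wt w D h := fun h =>
    (Finset.prod_sdiff hDC).symm
  have hmax := hg.2 k' hgraph
  rw [hsplit k', hsplit g, wt_congr w (g := k') (g' := g) (C := C \ D),
    wt_congr w (g := k') (g' := k) (C := D)] at hmax
  · have hrest : 0 < wt w (C \ D) g := by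
      rw [hsplit g] at hpos
      exact pos_of_mul_pos_left hpos (wt_nonneg hw _ _)
    refine le_of_mul_le_mul_left ?_ hrest
    linarith
  · exact fun s hs => if_pos hs
  · exact fun s hs => if_neg (Finset.mem_sdiff.mp hs).2

lemma IsMaximal.edge_weight_ge_of_fixed {w : Matrix S S ℝ} (hw : ∀ s t, 0 ≤ w s t)
    (hbal : ∀ s, ∑ t, w s t = ∑ t, w t s) {ζ b : ℝ} (hb : 0 < b)
    (hflow : ∀ D : Finset S, D.Nonempty → D ≠ univ → ζ ≤ ∑ s ∈ D, ∑ t ∈ Dᶜ, w s t)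
    {C : Finset S} (hC : C ≠ univ) {g : S → S} (hg : IsMaximal w C b g)
    (hpos : 0 < wt w C g) (hfix : ∀ s ∉ C, g s = s) {r : S} (hr : r ∈ C) :
    b * ζ ≤ (Fintype.card S : ℝ) ^ (Fintype.card S - 1) * w r (g r) := by
  classical
  set D : Finset S := univ.filter fun x => ∃ n, g^[n] x = r with hDdef
  have memD : ∀ x, x ∈ D ↔ ∃ n, g^[n] x = r := fun x => by simp [hDdef]
  have hDC : D ⊆ C := by
    intro x hx
    by_contra hxC
    obtain ⟨n, hn⟩ := (memD x).mp hx
    rw [iterate_fixed_of_notMem hfix hxC] at hn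
    exact hxC (hn ▸ hr)
  have hrD : r ∈ D := (memD r).mpr ⟨0, rfl⟩
  have hDback : ∀ x, g x ∈ D → x ∈ D := fun x hx => by
    obtain ⟨n, hn⟩ := (memD _).mp hx
    exact (memD x).mpr ⟨n + 1, hn⟩
  have hDuniv : D ≠ univ := fun h => hC (Finset.univ_subset_iff.mp (h ▸ hDC))
  have hDcard : #D ≤ Fintype.card S - 1 := by
    have := Finset.card_lt_univ_of_notMem (s := D) (x := _)
      (not_forall.mp fun h => hDuniv (Finset.eq_univ_iff_forall.mpr h)).choose_spec
    omega
  have hgD := hg.restrict hw hpos hDC hDback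
  set B := D.erase r with hB
  set gB : S → S := fun x => if x ∈ B then g x else x with hgB
  have hgBmem : gB ∈ Gset B := mem_Gset.mpr
    ⟨hg.1.of_subset_of_eqOn ((Finset.erase_subset _ _).trans hDC) fun s hs => if_pos hs,
      fun s hs => if_neg hs⟩
  have hlead : ∀ n x, g^[n] x = r → ∃ n, gB^[n] x = r := by
    intro n
    induction n with
    | zero => exact fun x hx => ⟨0, hx⟩
    | succ n ih =>
      intro x hx
      by_cases hxr : x = r
      · exact ⟨0, hxr⟩
      · obtain ⟨m, hm⟩ := ih (g x) hx
        have hxB : x ∈ B := Finset.mem_erase.mpr ⟨hxr, (memD x).mpr ⟨n + 1, hx⟩⟩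
        have hgx : gB x = g x := if_pos hxB
        exact ⟨m + 1, by rw [Function.iterate_succ_apply, hgx]; exact hm⟩
  have hwtB : wt w B gB = wt w B g := wt_congr w fun s hs => if_pos hs
  have hwtD : w r (g r) * wt w B g = wt w D g := mul_wt_erase w hrD g
  have hwtBpos : 0 < wt w B g := by
    refine Finset.prod_pos fun s hs => (hw _ _).lt_of_ne' fun h => hpos.ne' ?_
    exact Finset.prod_eq_zero (hDC (Finset.mem_of_mem_erase hs)) h
  have hzero : ∀ s ∉ D, leadWeight w B r s = 0 := fun s hs =>
    leadWeight_eq_zero w (fun h => hs (Finset.mem_of_mem_erase h)) fun h => hs (h ▸ hrD)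
  have hlower : wt w B g * ζ ≤ ∑ u ∈ D, leadWeight w B r u * ∑ v ∈ Dᶜ, w v u := by
    calc wt w B g * ζ ≤ wt w B g * ∑ u ∈ D, ∑ v ∈ Dᶜ, w v u := by
          rw [inflow_eq_outflow hbal]
          exact mul_le_mul_of_nonneg_left (hflow D ⟨r, hrD⟩ hDuniv) hwtBpos.le
      _ ≤ _ := by
          rw [Finset.mul_sum]
          refine Finset.sum_le_sum fun u hu => mul_le_mul_of_nonneg_right ?_
            (Finset.sum_nonneg fun _ _ => hw _ _)
          obtain ⟨n, hn⟩ := (memD u).mp hu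
          exact hwtB ▸ wt_le_leadWeight hw hgBmem (hlead n u hn)
  have hupper : ∑ u ∈ D, leadWeight w B r u * ∑ v ∈ Dᶜ, w v u ≤
      (Fintype.card S : ℝ) ^ #D * (wt w D g / b) := by
    rw [sum_mul_inflow_eq hbal hzero, ← Finset.add_sum_erase D _ hrD]
    have hroot := sum_mul_leadWeight_root_le (w := w) hrD (M := wt w D g / b)
      (div_nonneg (wt_nonneg hw _ _) hb.le)
      fun k hk => (le_div_iff₀' hb).mpr (hgD.2 k hk)
    have hrest : ∑ u ∈ B, (∑ v, w u v * leadWeight w B r u -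
        ∑ v, w u v * leadWeight w B r v) ≤ 0 :=
      Finset.sum_nonpos fun u hu =>
        sub_nonpos.mpr (sum_mul_leadWeight_le hw (Finset.notMem_erase r D) hu)
    linarith
  have hcard1 : (1 : ℝ) ≤ Fintype.card S := by
    exact_mod_cast Fintype.card_pos_iff.mpr ⟨r⟩
  have hpow : (Fintype.card S : ℝ) ^ #D ≤ (Fintype.card S : ℝ) ^ (Fintype.card S - 1) :=
    pow_le_pow_right₀ hcard1 hDcard
  have hfinal : wt w B g * ζ ≤
      (Fintype.card S : ℝ) ^ (Fintype.card S - 1) * (wt w D g / b) :=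
    hlower.trans (hupper.trans (mul_le_mul_of_nonneg_right hpow
      (div_nonneg (wt_nonneg hw _ _) hb.le)))
  rw [← mul_div_assoc, le_div_iff₀ hb, ← hwtD] at hfinal
  refine le_of_mul_le_mul_left ?_ hwtBpos
  linarith

/-- For balanced weights whose outflow from every nonempty proper subset is at least `ζ`, every
edge of a `b`-maximal `C`-graph of positive weight has weight at least `b * ζ / |S| ^ (|S| - 1)`. -/
lemma IsMaximal.edge_weight_ge {w : Matrix S S ℝ} (hw : ∀ s t, 0 ≤ w s t)
    (hbal : ∀ s, ∑ t, w s t = ∑ t, w t s) {ζ b : ℝ} (hb : 0 < b)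
    (hflow : ∀ D : Finset S, D.Nonempty → D ≠ univ → ζ ≤ ∑ s ∈ D, ∑ t ∈ Dᶜ, w s t)
    {C : Finset S} (hC : C ≠ univ) {g : S → S} (hg : IsMaximal w C b g)
    (hpos : 0 < wt w C g) {r : S} (hr : r ∈ C) :
    b * ζ ≤ (Fintype.card S : ℝ) ^ (Fintype.card S - 1) * w r (g r) := by
  set g' : S → S := fun x => if x ∈ C then g x else x with hg'
  have heq : ∀ s ∈ C, g' s = g s := fun s hs => if_pos hs
  have hwt : wt w C g' = wt w C g := wt_congr w heq
  have hmax : IsMaximal w C b g' :=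
    ⟨hg.1.of_subset_of_eqOn subset_rfl heq, fun k hk => hwt ▸ hg.2 k hk⟩
  rw [← heq r hr]
  exact hmax.edge_weight_ge_of_fixed hw hbal hb hflow hC (hwt ▸ hpos)
    (fun s hs => if_neg hs) hr

omit [DecidableEq S] in
lemma mul_pow_le_Lconst (h : 2 ≤ Fintype.card S) :
    Fintype.card S * (Fintype.card S - 1) ^ Fintype.card S ≤ Lconst S := by
  have hmem : Fintype.card S - 1 ∈ Finset.Ico 1 (Fintype.card S) := by
    rw [Finset.mem_Ico]; omega
  have hle := Finset.single_le_sum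
    (f := fun n => (Fintype.card S).choose n * n ^ Fintype.card S) (fun _ _ => Nat.zero_le _) hmem
  have hchoose : (Fintype.card S).choose (Fintype.card S - 1) = Fintype.card S := by
    rw [Nat.choose_symm (by omega : 1 ≤ Fintype.card S), Nat.choose_one_right]
  simp only [hchoose] at hle
  exact hle

lemma pow_self_le_four_mul_pred_pow {n : ℕ} (hn : 2 ≤ n) :
    (n : ℝ) ^ n ≤ 4 * ((n : ℝ) - 1) ^ n := by
  have hn' : (2 : ℝ) ≤ n := by exact_mod_cast hn
  have hbern := one_add_mul_self_le_rpow_one_add (s := -1 / (n : ℝ))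
    (by rw [le_div_iff₀ (by linarith)]; linarith) (p := (n : ℝ) / 2) (by linarith)
  have hbase : 1 + -1 / (n : ℝ) = ((n : ℝ) - 1) / n := by field_simp; ring
  have hnonneg : 0 ≤ ((n : ℝ) - 1) / n := div_nonneg (by linarith) (by linarith)
  have hhalf : 1 + (n : ℝ) / 2 * (-1 / (n : ℝ)) = 1 / 2 := by field_simp; norm_num
  rw [hbase, hhalf] at hbern
  have hsq : ((((n : ℝ) - 1) / n) ^ ((n : ℝ) / 2)) ^ 2 = (((n : ℝ) - 1) / n) ^ n := by
    rw [← Real.rpow_natCast, ← Real.rpow_mul hnonneg, ← Real.rpow_natCast _ n]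
    congr 1
    push_cast
    ring
  have hquarter : (1 : ℝ) / 4 ≤ (((n : ℝ) - 1) / n) ^ n := by
    rw [← hsq]
    nlinarith
  rw [div_pow, le_div_iff₀ (by positivity)] at hquarter
  linarith

omit [DecidableEq S] in
lemma card_pow_mul_le_of_lt_div (hcard : 2 ≤ Fintype.card S) {β ε : ℝ} (hε0 : 0 < ε)
    (hε1 : ε < β * (1 - β) / ((Lconst S : ℝ) * (Fintype.card S : ℝ) ^ 4)) :
    16 * ((Fintype.card S : ℝ) ^ (Fintype.card S - 1) * ε) ≤ β * (1 - β) := by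
  have hL := mul_pow_le_Lconst hcard
  have hpow := pow_self_le_four_mul_pred_pow hcard
  set n := Fintype.card S with hn
  have hn' : (2 : ℝ) ≤ n := by exact_mod_cast hcard
  have hLr : (n : ℝ) * ((n : ℝ) - 1) ^ n ≤ Lconst S := by
    have h : ((n * (n - 1) ^ n : ℕ) : ℝ) ≤ Lconst S := by exact_mod_cast hL
    rwa [Nat.cast_mul, Nat.cast_pow, Nat.cast_sub (by omega), Nat.cast_one] at h
  have hpos : 0 < (n : ℝ) * ((n : ℝ) - 1) ^ n :=
    mul_pos (by linarith) (pow_pos (by linarith) _)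
  have hden : 0 < (Lconst S : ℝ) * (n : ℝ) ^ 4 :=
    mul_pos (hpos.trans_le hLr) (pow_pos (by linarith) _)
  rw [lt_div_iff₀ hden] at hε1
  have hnn : (n : ℝ) ^ n = n * (n : ℝ) ^ (n - 1) := by
    rw [← pow_succ', Nat.sub_add_cancel (by omega)]
  have hsix : (64 : ℝ) ≤ (n : ℝ) ^ 6 :=
    le_trans (by norm_num) (pow_le_pow_left₀ (by norm_num) hn' 6)
  have hX : 0 ≤ (n : ℝ) ^ (n - 1) := by positivity
  have hcmp : 16 * (n : ℝ) ^ (n - 1) ≤ (Lconst S : ℝ) * (n : ℝ) ^ 4 := by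
    calc 16 * (n : ℝ) ^ (n - 1) ≤ (n : ℝ) ^ 6 / 4 * (n : ℝ) ^ (n - 1) :=
          mul_le_mul_of_nonneg_right (by linarith) hX
      _ = (n : ℝ) * ((n : ℝ) ^ n / 4) * (n : ℝ) ^ 4 := by rw [hnn]; ring
      _ ≤ (n : ℝ) * ((n : ℝ) - 1) ^ n * (n : ℝ) ^ 4 := by
          gcongr
          linarith
      _ ≤ _ := by gcongr
  nlinarith [mul_le_mul_of_nonneg_left hcmp hε0.le]

lemma zeta_le_outflow {q : Matrix S S ℝ} {μ : S → ℝ} (hq : ∀ s t, 0 ≤ q s t)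
    (hμ : ∀ s, 0 ≤ μ s) {D : Finset S} (hD : D.Nonempty) (hD' : D ≠ univ) :
    zeta q μ ≤ ∑ s ∈ D, μ s * ∑ t ∈ Dᶜ, q s t := by
  refine csInf_le ⟨0, ?_⟩ ⟨D, hD, hD', rfl⟩
  rintro x ⟨E, -, -, rfl⟩
  exact Finset.sum_nonneg fun s _ => mul_nonneg (hμ s) (Finset.sum_nonneg fun t _ => hq s t)

omit [Fintype S] [DecidableEq S] in
lemma wt_le_pow_mul_wt {w w' : Matrix S S ℝ} {c : ℝ} (hw : ∀ s t, 0 ≤ w s t) {C : Finset S}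
    {g : S → S} (h : ∀ s ∈ C, w s (g s) ≤ c * w' s (g s)) : wt w C g ≤ c ^ #C * wt w' C g := by
  rw [wt, wt, ← Finset.prod_const, ← Finset.prod_mul_distrib]
  exact Finset.prod_le_prod (fun s _ => hw _ _) h

omit [Fintype S] [DecidableEq S] in
/-- Multiplying the rows of a matrix by nonnegative factors preserves maximality. -/
lemma IsMaximal.mul_rows {q : Matrix S S ℝ} {C : Finset S} {b : ℝ} {g : S → S}
    (hg : IsMaximal q C b g) {μ : S → ℝ} (hμ : ∀ s, 0 ≤ μ s) :
    IsMaximal (fun s t => μ s * q s t) C b g := by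
  refine ⟨hg.1, fun k hk => ?_⟩
  have hwt : ∀ h : S → S, wt (fun s t => μ s * q s t) C h = (∏ s ∈ C, μ s) * wt q C h :=
    fun h => Finset.prod_mul_distrib
  rw [hwt, hwt, mul_left_comm]
  exact mul_le_mul_of_nonneg_left (hg.2 k hk) (Finset.prod_nonneg fun s _ => hμ s)

omit [DecidableEq S] in
/-- Every proper subset `C` has a `C`-graph of largest weight. -/
lemma exists_isMaximal_one {w : Matrix S S ℝ} {C : Finset S} (hC : C ≠ univ) :
    ∃ g, IsMaximal w C 1 g := by
  classical
  obtain ⟨x, hx⟩ := not_forall.mp fun h => hC (Finset.eq_univ_iff_forall.mpr h)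
  have hne : (univ.filter fun g : S → S => IsCGraph C g).Nonempty :=
    ⟨fun _ => x, by
      rw [Finset.mem_filter, isCGraph_iff_forall_exists_notMem]
      exact ⟨Finset.mem_univ _, fun y => ⟨1, hx⟩⟩⟩
  obtain ⟨g, hg, hmax⟩ := Finset.exists_max_image _ (wt w C) hne
  exact ⟨g, (Finset.mem_filter.mp hg).2, fun k hk => by
    rw [one_mul]; exact hmax k (Finset.mem_filter.mpr ⟨Finset.mem_univ _, hk⟩)⟩

omit [Fintype S] [DecidableEq S] in
/-- Maximality of `g` transfers from `w` to `w'`, up to a constant factor, when `w` is at most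
`a * w'` along `g` and at least `c * w'` along a graph of largest weight for `w'`. -/
lemma IsMaximal.of_comparison {w w' : Matrix S S ℝ} {a b b' c : ℝ} {C : Finset S} {g k : S → S}
    (ha : 0 < a) (hb : 0 ≤ b) (hb' : 0 ≤ b') (hc : 0 ≤ c) (hw : ∀ s t, 0 ≤ w s t)
    (hw' : ∀ s t, 0 ≤ w' s t) (hg : IsMaximal w C b g) (hk : IsMaximal w' C 1 k)
    (hgle : ∀ s ∈ C, w s (g s) ≤ a * w' s (g s))
    (hkle : ∀ s ∈ C, c * w' s (k s) ≤ w s (k s)) (hbc : b' * a ^ #C ≤ b * c ^ #C) :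
    IsMaximal w' C b' g := by
  refine ⟨hg.1, fun j hj => ?_⟩
  have hjk : wt w' C j ≤ wt w' C k := by simpa using hk.2 j hj
  refine (mul_le_mul_of_nonneg_left hjk hb').trans ?_
  have hupper : wt w C g ≤ a ^ #C * wt w' C g := wt_le_pow_mul_wt hw hgle
  have hlower : c ^ #C * wt w' C k ≤ wt w C k := by
    rw [wt, wt, ← Finset.prod_const, ← Finset.prod_mul_distrib]
    exact Finset.prod_le_prod (fun s _ => mul_nonneg hc (hw' _ _)) hkle
  have hmax := hg.2 k hk.1
  refine le_of_mul_le_mul_left ?_ (pow_pos ha #C)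
  calc a ^ #C * (b' * wt w' C k) = b' * a ^ #C * wt w' C k := by ring
    _ ≤ b * c ^ #C * wt w' C k := mul_le_mul_of_nonneg_right hbc (wt_nonneg hw' _ _)
    _ = b * (c ^ #C * wt w' C k) := by ring
    _ ≤ b * wt w C k := mul_le_mul_of_nonneg_left hlower hb
    _ ≤ a ^ #C * wt w' C g := hmax.trans hupper

lemma three_sixteenths_mul_pow_le {β x : ℝ} {m n : ℕ} (hβ0 : 0 ≤ β) (hβ : β < 1 / 2 ^ n)
    (hn : 1 ≤ n) (hm : m ≤ n) (hx : 16 * x ≤ β) :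
    3 * β / 16 * (1 + β) ^ m ≤ β * ((1 - β) * (1 - x)) ^ m := by
  have hmβ : (m : ℝ) * β ≤ 1 / 2 := by
    have hn2 : 2 * n ≤ 2 ^ n := by
      obtain ⟨k, rfl⟩ := Nat.exists_eq_add_of_le' hn
      have : k + 1 ≤ 2 ^ k := Nat.lt_two_pow_self
      rw [pow_succ']
      omega
    have hn2' : 2 * (m : ℝ) ≤ 2 ^ n := by
      exact_mod_cast (Nat.mul_le_mul_left 2 hm).trans hn2
    have hβn : β * 2 ^ n < 1 := by rwa [lt_div_iff₀ (by positivity)] at hβ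
    nlinarith [mul_le_mul_of_nonneg_left hn2' hβ0]
  have hβ1 : β ≤ 1 / 2 := by
    refine hβ.le.trans (one_div_le_one_div_of_le (by norm_num) ?_)
    calc (2 : ℝ) = 2 ^ 1 := (pow_one _).symm
      _ ≤ 2 ^ n := pow_le_pow_right₀ (by norm_num) hn
  have hpβ : 1 / 2 ≤ (1 - β) ^ m := by
    have := one_add_mul_le_pow (a := -β) (by linarith) m
    rw [← sub_eq_add_neg] at this
    linarith
  have hpx : 3 / 4 ≤ (1 - x) ^ m := by
    have := one_add_mul_le_pow (a := -x) (by linarith) m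
    rw [← sub_eq_add_neg] at this
    nlinarith [mul_le_mul_of_nonneg_left hx (Nat.cast_nonneg (α := ℝ) m)]
  have hup : (1 + β) ^ m ≤ 2 := by
    have hprod : (1 - β) ^ m * (1 + β) ^ m ≤ 1 := by
      rw [← mul_pow]
      exact pow_le_one₀ (by nlinarith) (by nlinarith)
    have hpos : 0 ≤ (1 + β) ^ m := by positivity
    nlinarith
  have hlow : 3 / 8 ≤ (1 - β) ^ m * (1 - x) ^ m := by nlinarith
  rw [mul_pow]
  nlinarith [mul_le_mul_of_nonneg_left hup hβ0, mul_le_mul_of_nonneg_left hlow hβ0]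

/-- Every edge of a `β`-maximal `C`-graph under a matrix close to `q` is frequent. -/
lemma IsMaximal.edge_frequent
    (hcard : 2 ≤ Fintype.card S) {q qh : Matrix S S ℝ} {μ : S → ℝ} {β ε : ℝ}
    (hβ0 : 0 < β) (hβ1 : β < 1 / 2 ^ Fintype.card S) (hε0 : 0 < ε)
    (hε1 : ε < β * (1 - β) / ((Lconst S : ℝ) * (Fintype.card S : ℝ) ^ 4))
    (hq : IsTransition q) (hμ : IsStationary q μ) (hqh : IsTransition qh)
    (hclose : IsClose q qh μ (zeta q μ) ε β) {C : Finset S} (hCproper : C ≠ univ)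
    {g : S → S} (hg : IsMaximal qh C β g) {s : S} (hs : s ∈ C) :
    ε * zeta q μ ≤ μ s * qh s (g s) := by
  have hμ0 := hμ.1
  rcases le_or_gt (zeta q μ) 0 with hz | hz
  · exact (mul_nonpos_of_nonneg_of_nonpos hε0.le hz).trans (mul_nonneg (hμ0 s) (hqh.1 _ _))
  have hsmall := card_pow_mul_le_of_lt_div hcard hε0 hε1
  set ζ := zeta q μ with hζ
  set X := (Fintype.card S : ℝ) ^ (Fintype.card S - 1) with hX
  have hXpos : 0 < X := pow_pos (by exact_mod_cast (by omega : 0 < Fintype.card S)) _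
  have hβhalf : β ≤ 1 / 2 := by
    refine hβ1.le.trans (one_div_le_one_div_of_le (by norm_num) ?_)
    calc (2 : ℝ) = 2 ^ 1 := (pow_one _).symm
      _ ≤ 2 ^ Fintype.card S := pow_le_pow_right₀ (by norm_num) (by omega)
  have hx0 : 0 < X * ε := mul_pos hXpos hε0
  have hxβ : 16 * (X * ε) ≤ β := hsmall.trans (by nlinarith)
  have hδ : 0 < ε * ζ := mul_pos hε0 hz
  set w : Matrix S S ℝ := fun s t => μ s * q s t with hwdef
  set wh : Matrix S S ℝ := fun s t => μ s * qh s t with hwhdef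
  set w' : Matrix S S ℝ := fun s t => w s t + ε * ζ with hw'def
  have hw : ∀ s t, 0 ≤ w s t := fun s t => mul_nonneg (hμ0 s) (hq.1 s t)
  have hwh : ∀ s t, 0 ≤ wh s t := fun s t => mul_nonneg (hμ0 s) (hqh.1 s t)
  have hw'w : ∀ s t, w' s t = w s t + ε * ζ := fun _ _ => rfl
  have hw' : ∀ s t, 0 < w' s t := fun s t => add_pos_of_nonneg_of_pos (hw s t) hδ
  have hwclose : ∀ s t, (ε * ζ ≤ w s t ∨ ε * ζ ≤ wh s t) →
      (1 - β) * w s t ≤ wh s t ∧ wh s t ≤ (1 + β) * w s t := by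
    intro s t h
    obtain ⟨h1, h2⟩ := abs_le.mp (hclose s t h)
    have h1' := mul_le_mul_of_nonneg_left h1 (hμ0 s)
    have h2' := mul_le_mul_of_nonneg_left h2 (hμ0 s)
    simp only [hwdef, hwhdef]
    constructor <;> linarith
  have hbal : ∀ s, ∑ t, w' s t = ∑ t, w' t s := by
    intro s
    simp only [hw'w, Finset.sum_add_distrib, hwdef, ← Finset.mul_sum, hq.2 s, hμ.2.2 s, mul_one]
  have hflow : ∀ D : Finset S, D.Nonempty → D ≠ univ → ζ ≤ ∑ s ∈ D, ∑ t ∈ Dᶜ, w' s t := by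
    intro D hD hD'
    refine (zeta_le_outflow hq.1 hμ0 hD hD').trans (Finset.sum_le_sum fun s _ => ?_)
    rw [Finset.mul_sum]
    exact Finset.sum_le_sum fun t _ => le_add_of_nonneg_right hδ.le
  have hwtpos : ∀ h : S → S, 0 < wt w' C h := fun h => Finset.prod_pos fun s _ => hw' s _
  obtain ⟨k, hk⟩ := exists_isMaximal_one (w := w') hCproper
  have hkw : ∀ s ∈ C, (1 - X * ε) * w' s (k s) ≤ w s (k s) ∧ ε * ζ ≤ w s (k s) := by
    intro s hs
    have h := hk.edge_weight_ge (fun s t => (hw' s t).le) hbal one_pos hflow hCproper (hwtpos k) hs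
    have hεh := mul_le_mul_of_nonneg_left h hε0.le
    rw [hw'w] at h hεh ⊢
    refine ⟨by linarith, le_of_mul_le_mul_left (?_ : X * (ε * ζ) ≤ X * w s (k s)) hXpos⟩
    nlinarith
  have hg' : IsMaximal w' C (3 * β / 16) g := by
    refine (hg.mul_rows hμ0).of_comparison (a := 1 + β) (c := (1 - β) * (1 - X * ε))
      (by linarith) hβ0.le (by linarith) (mul_nonneg (by linarith) (by linarith)) hwh
      (fun s t => (hw' s t).le) hk (fun s hs => ?_) (fun s hs => ?_)
      (three_sixteenths_mul_pow_le hβ0.le hβ1 (by omega) (Finset.card_le_univ C) hxβ)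
    · have hwp := hw' s (g s)
      rcases lt_or_ge (wh s (g s)) (ε * ζ) with h | h
      · nlinarith [hw s (g s), hw'w s (g s)]
      · refine (hwclose s (g s) (Or.inr h)).2.trans (mul_le_mul_of_nonneg_left ?_ (by linarith))
        rw [hw'w]
        linarith
    · obtain ⟨h1, h2⟩ := hkw s hs
      rw [mul_assoc]
      exact (mul_le_mul_of_nonneg_left h1 (by linarith)).trans (hwclose s _ (Or.inl h2)).1
  have hedge := hg'.edge_weight_ge (fun s t => (hw' s t).le) hbal (by linarith) hflow hCproper
    (hwtpos g) hs
  have hfreq : 2 * (ε * ζ) ≤ w s (g s) := by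
    rw [hw'w] at hedge
    refine le_of_mul_le_mul_left (?_ : X * (2 * (ε * ζ)) ≤ X * w s (g s)) hXpos
    nlinarith
  have hlow := (hwclose s (g s) (Or.inl (by linarith))).1
  change ε * ζ ≤ wh s (g s)
  nlinarith

/-- Lemma `main`: every edge of a `β`-maximal `C`-graph under `q`
(resp. under `q̂`) is frequent: `μ_s·q(g(s)|s) ≥ ε·ζ_q` (resp. `μ_s·q̂(g(s)|s) ≥ ε·ζ_q`). -/
theorem maximal_graph_edges_frequent
    (hcard : 2 ≤ Fintype.card S)
    (q qh : Matrix S S ℝ) (μ : S → ℝ) (β ε : ℝ)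
    (hβ0 : 0 < β) (hβ1 : β < 1 / 2 ^ Fintype.card S)
    (hε0 : 0 < ε)
    (hε1 : ε < β * (1 - β) / ((Lconst S : ℝ) * (Fintype.card S : ℝ) ^ 4))
    (hq : IsTransition q) (hqirr : IsIrreducible q) (hμ : IsStationary q μ)
    (hqh : IsTransition qh)
    (hclose : IsClose q qh μ (zeta q μ) ε β)
    (C : Finset S) (hCne : C.Nonempty) (hCproper : C ≠ Finset.univ) :
    (∀ g : S → S, IsMaximal q C β g → ∀ s ∈ C, ε * zeta q μ ≤ μ s * q s (g s)) ∧
      ∀ g : S → S, IsMaximal qh C β g → ∀ s ∈ C, ε * zeta q μ ≤ μ s * qh s (g s) := by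
  refine ⟨fun g hg s hs => ?_, fun g hg s hs => ?_⟩
  · refine hg.edge_frequent hcard hβ0 hβ1 hε0 hε1 hq hμ hq (fun s t _ => ?_) hCproper hs
    rw [sub_self, abs_zero]
    exact mul_nonneg hβ0.le (hq.1 s t)
  · exact hg.edge_frequent hcard hβ0 hβ1 hε0 hε1 hq hμ hqh hclose hCproper hs

end PerturbedMC
end

section
/- Let q be an irreducible transition matrix on S with stationary distribution μ. Then for every s ∈ S, μ_s = (Σ_{g∈G(S\{s})} p(g)) / (Σ_{y∈S} Σ_{g∈G(S\{y})} p(g)). -/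
open Finset

namespace PerturbedMC

variable {S : Type*} [Fintype S] [DecidableEq S]

/-- Every orbit of `g` passes through `s`. -/
def AllReach {S : Type*} (g : S → S) (s : S) : Prop := ∀ x, ∃ n : ℕ, g^[n] x = s

theorem AllReach.congr {S : Type*} {g h : S → S} {s : S} (hg : AllReach g s)
    (hgh : ∀ x, x ≠ s → g x = h x) : AllReach h s := by
  intro x
  obtain ⟨n, hn⟩ := hg x
  induction n generalizing x with
  | zero => exact ⟨0, hn⟩
  | succ n ih =>
    by_cases hx : x = s
    · exact ⟨0, hx⟩
    · obtain ⟨m, hm⟩ := ih (g x) hn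
      exact ⟨m + 1, by rw [Function.iterate_succ_apply, ← hgh x hx, hm]⟩

theorem allReach_update_iff {S : Type*} [DecidableEq S] {g : S → S} {s u : S} :
    AllReach (Function.update g s u) s ↔ AllReach g s :=
  ⟨fun h => h.congr fun _ hx => Function.update_of_ne hx u g,
    fun h => h.congr fun _ hx => (Function.update_of_ne hx u g).symm⟩

theorem AllReach.apply {S : Type*} {h : S → S} {s : S} (hs : AllReach h s) :
    AllReach h (h s) := by
  intro x
  obtain ⟨n, hn⟩ := hs x
  exact ⟨n + 1, by rw [Function.iterate_succ_apply', hn]⟩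

theorem AllReach.iterate {S : Type*} {h : S → S} {s : S} (hs : AllReach h s) (n : ℕ) :
    AllReach h (h^[n] s) := by
  induction n with
  | zero => exact hs
  | succ n ih => rw [Function.iterate_succ_apply']; exact ih.apply

theorem AllReach.existsUnique_pred {S : Type*} {h : S → S} {t : S} (ht : AllReach h t) :
    ∃! s, h s = t ∧ AllReach h s := by
  obtain ⟨n, hn⟩ := ht (h t)
  have hper : ∀ s, h s = t ∧ AllReach h s → ∃ m, 0 < m ∧ Function.IsPeriodicPt h m s := by
    rintro s ⟨hs, hr⟩
    obtain ⟨m, hm⟩ := hr t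
    refine ⟨m + 1, m.succ_pos, ?_⟩
    rw [Function.IsPeriodicPt, Function.IsFixedPt, Function.iterate_succ_apply, hs, hm]
  have hex : h (h^[n] t) = t ∧ AllReach h (h^[n] t) :=
    ⟨by rw [← Function.iterate_succ_apply' h, Function.iterate_succ_apply, hn], ht.iterate n⟩
  refine ⟨h^[n] t, hex, fun s hs => ?_⟩
  obtain ⟨m, hm, hpm⟩ := hper s hs
  obtain ⟨k, hk, hpk⟩ := hper _ hex
  exact hpm.eq_of_apply_eq hpk hm hk (hs.1.trans hex.1.symm)

theorem isCGraph_compl_singleton_iff (g : S → S) (s : S) :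
    IsCGraph ({s} : Finset S)ᶜ g ↔ AllReach g s := by
  constructor
  · intro hg x
    by_contra! hx
    obtain ⟨i, j, hij, heq⟩ := Finite.exists_ne_map_eq_of_infinite fun n : ℕ => g^[n] x
    wlog hlt : i < j generalizing i j
    · exact this j i hij.symm heq.symm (by omega)
    refine hg ⟨j - i, fun n => g^[i + n] x, by omega, ?_, fun n _ => by simpa using hx _,
      fun n _ => ?_⟩
    · simpa [Nat.add_sub_cancel' hlt.le] using heq.symm
    · change g (g^[i + n] x) = g^[i + n + 1] x
      rw [Function.iterate_succ_apply']
  · rintro hr ⟨k, f, hk, hper, hmem, hstep⟩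
    have horb : ∀ n, ∃ i < k, g^[n] (f 0) = f i := by
      intro n
      induction n with
      | zero => exact ⟨0, hk, rfl⟩
      | succ n ih =>
        obtain ⟨i, hi, hfi⟩ := ih
        rw [Function.iterate_succ_apply', hfi, hstep i hi]
        by_cases hik : i + 1 = k
        · exact ⟨0, hk, by rw [hik, hper]⟩
        · exact ⟨i + 1, by omega, rfl⟩
    obtain ⟨n, hn⟩ := hr (f 0)
    obtain ⟨i, hi, hfi⟩ := horb n
    simpa [← hfi, hn] using hmem i hi

theorem mem_Gset_compl_singleton {g : S → S} {s : S} :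
    g ∈ Gset ({s} : Finset S)ᶜ ↔ AllReach g s ∧ g s = s := by
  simp [Gset, isCGraph_compl_singleton_iff]

/-- The total weight of the graphs rooted at `s`. -/
noncomputable def rootedWeight (q : Matrix S S ℝ) (s : S) : ℝ :=
  ∑ g ∈ Gset (({s} : Finset S)ᶜ), wt q (({s} : Finset S)ᶜ) g

open Classical in
/-- Redirecting the root `s` to `t` turns rooted graphs into self-maps of `S` sending `s` to `t`
all of whose orbits pass through `s`. -/
theorem rootedWeight_mul (q : Matrix S S ℝ) (s t : S) :
    rootedWeight q s * q s t =
      ∑ h : S → S, if h s = t ∧ AllReach h s then ∏ x, q x (h x) else 0 := by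
  rw [rootedWeight, Finset.sum_mul, ← Finset.sum_filter]
  refine Finset.sum_bij' (fun g _ => Function.update g s t) (fun h _ => Function.update h s s)
    ?_ ?_ ?_ ?_ ?_
  · intro g hg
    rw [mem_Gset_compl_singleton] at hg
    simp [allReach_update_iff, hg.1]
  · intro h hh
    rw [mem_Gset_compl_singleton]
    simp only [Finset.mem_filter, Finset.mem_univ, true_and] at hh
    simp [allReach_update_iff, hh.2]
  · intro g hg
    rw [mem_Gset_compl_singleton] at hg
    rw [Function.update_idem, Function.update_eq_self_iff, hg.2]
  · intro h hh
    simp only [Finset.mem_filter, Finset.mem_univ, true_and] at hh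
    rw [Function.update_idem, Function.update_eq_self_iff, hh.1]
  · intro g _
    rw [Fintype.prod_eq_mul_prod_compl s, Function.update_self, mul_comm, wt]
    congr 1
    refine Finset.prod_congr rfl fun x hx => ?_
    rw [Function.update_of_ne (by simpa using hx)]

/-- The Markov chain tree theorem: rooted weights form a stationary vector. -/
theorem sum_rootedWeight_mul (q : Matrix S S ℝ) (hq : IsTransition q) (t : S) :
    ∑ s, rootedWeight q s * q s t = rootedWeight q t := by
  classical
  have hout : rootedWeight q t = ∑ u, rootedWeight q t * q t u := by
    rw [← Finset.mul_sum, hq.2, mul_one]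
  rw [hout]
  simp only [rootedWeight_mul]
  rw [Finset.sum_comm, Finset.sum_comm (s := (Finset.univ : Finset S))]
  refine Finset.sum_congr rfl fun h _ => ?_
  by_cases ht : AllReach h t
  · obtain ⟨s, hs, huniq⟩ := ht.existsUnique_pred
    rw [Finset.sum_eq_single s (fun b _ hb => if_neg fun hb' => hb (huniq b hb')) (by simp),
      if_pos hs]
    simp [ht]
  · rw [Finset.sum_eq_zero fun s _ => if_neg fun hs : h s = t ∧ AllReach h s =>
      ht (hs.1 ▸ hs.2.apply)]
    simp [ht]

theorem rootedWeight_nonneg (q : Matrix S S ℝ) (hq : IsTransition q) (s : S) :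
    0 ≤ rootedWeight q s :=
  Finset.sum_nonneg fun _ _ => Finset.prod_nonneg fun _ _ => hq.1 _ _

theorem pow_apply_nonneg {q : Matrix S S ℝ} (hq : IsTransition q) (n : ℕ) (s t : S) :
    0 ≤ (q ^ n) s t := by
  induction n generalizing s t with
  | zero => rw [pow_zero, Matrix.one_apply]; split_ifs <;> norm_num
  | succ n ih =>
    rw [pow_succ, Matrix.mul_apply]
    exact Finset.sum_nonneg fun _ _ => mul_nonneg (ih _ _) (hq.1 _ _)

theorem sum_mul_pow_apply {q : Matrix S S ℝ} {v : S → ℝ} (hv : ∀ t, ∑ s, v s * q s t = v t)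
    (n : ℕ) (t : S) : ∑ s, v s * (q ^ n) s t = v t := by
  have h1 : Matrix.vecMul v q = v := funext hv
  have h2 : Matrix.vecMul v (q ^ n) = v := by
    induction n with
    | zero => simp
    | succ n ih => rw [pow_succ, ← Matrix.vecMul_vecMul, ih, h1]
  exact congrFun h2 t

/-- A nonnegative invariant vector of an irreducible chain that vanishes somewhere is zero. -/
theorem eq_zero_of_invariant {q : Matrix S S ℝ} (hq : IsTransition q) (hqirr : IsIrreducible q)
    {v : S → ℝ} (hv0 : ∀ s, 0 ≤ v s) (hv : ∀ t, ∑ s, v s * q s t = v t) {t : S} (ht : v t = 0)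
    (s : S) : v s = 0 := by
  obtain ⟨n, -, hn⟩ := hqirr s t
  have hsum := sum_mul_pow_apply hv n t
  rw [ht, Finset.sum_eq_zero_iff_of_nonneg
    fun x _ => mul_nonneg (hv0 x) (pow_apply_nonneg hq n x t)] at hsum
  exact (mul_eq_zero.mp (hsum s (Finset.mem_univ s))).resolve_right hn.ne'

/-- Invariant vectors of an irreducible chain are multiples of the stationary distribution. -/
theorem IsStationary.eq_sum_mul {q : Matrix S S ℝ} (hq : IsTransition q)
    (hqirr : IsIrreducible q) {μ : S → ℝ} (hμ : IsStationary q μ) {v : S → ℝ}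
    (hv : ∀ t, ∑ s, v s * q s t = v t) (s : S) : v s = (∑ y, v y) * μ s := by
  have hpos : ∀ x, 0 < μ x := by
    refine fun x => (hμ.1 x).lt_of_ne' fun hx => ?_
    have h1 := hμ.2.1
    simp [eq_zero_of_invariant hq hqirr hμ.1 hμ.2.2 hx] at h1
  obtain ⟨t, -, ht⟩ := Finset.exists_min_image Finset.univ (fun x => v x / μ x) ⟨s, by simp⟩
  have hmul : ∀ x, v x = v t / μ t * μ x := by
    intro x
    refine sub_eq_zero.mp (eq_zero_of_invariant (v := fun x => v x - v t / μ t * μ x) hq hqirr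
      (fun y => sub_nonneg.mpr ((le_div_iff₀ (hpos y)).mp (ht y (by simp)))) (fun y => ?_)
      (t := t) ?_ x)
    · simp only [sub_mul, Finset.sum_sub_distrib, mul_assoc]
      rw [hv, ← Finset.mul_sum, hμ.2.2]
    · simp [(hpos t).ne']
  have hsum : ∑ y, v y = v t / μ t := by
    rw [Finset.sum_congr rfl fun y _ => hmul y, ← Finset.mul_sum, hμ.2.1, mul_one]
  rw [hsum, ← hmul]

theorem rootedWeight_pos {q : Matrix S S ℝ} (hq : IsTransition q) (hqirr : IsIrreducible q)
    (s : S) : 0 < rootedWeight q s := by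
  classical
  have hex : ∀ x, ∃ n : ℕ, 0 < (q ^ n) x s := fun x => (hqirr x s).imp fun _ h => h.2
  have hnext : ∀ x, ∃ y, x ≠ s → 0 < q x y ∧ Nat.find (hex y) < Nat.find (hex x) := by
    intro x
    by_cases hx : x = s
    · exact ⟨s, fun h => (h hx).elim⟩
    have hspec := Nat.find_spec (hex x)
    obtain ⟨m, hm⟩ : ∃ m, Nat.find (hex x) = m + 1 := by
      refine Nat.exists_eq_succ_of_ne_zero fun h0 => ?_
      rw [h0, pow_zero, Matrix.one_apply_ne hx] at hspec
      exact hspec.false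
    rw [hm, pow_succ', Matrix.mul_apply] at hspec
    obtain ⟨y, -, hy⟩ := (Finset.sum_pos_iff_of_nonneg fun y _ =>
      mul_nonneg (hq.1 x y) (pow_apply_nonneg hq m y s)).mp hspec
    have hqy : 0 < q x y := (hq.1 x y).lt_of_ne' fun h => by simp [h] at hy
    refine ⟨y, fun _ => ⟨hqy, ?_⟩⟩
    rw [hm, Nat.lt_succ_iff]
    exact Nat.find_min' _ (pos_of_mul_pos_right hy hqy.le)
  choose g hg using hnext
  have hreach : AllReach g s := by
    intro x
    induction hd : Nat.find (hex x) using Nat.strong_induction_on generalizing x with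
    | _ d ih =>
      by_cases hx : x = s
      · exact ⟨0, hx⟩
      · obtain ⟨n, hn⟩ := ih _ (hd ▸ (hg x hx).2) (g x) rfl
        exact ⟨n + 1, hn⟩
  refine Finset.sum_pos' (fun _ _ => Finset.prod_nonneg fun _ _ => hq.1 _ _)
    ⟨Function.update g s s, ?_, Finset.prod_pos fun x hx => ?_⟩
  · simp [mem_Gset_compl_singleton, allReach_update_iff, hreach]
  · have hxs : x ≠ s := by simpa using hx
    rw [Function.update_of_ne hxs]
    exact (hg x hxs).1

/-- Freidlin–Wentzell: the stationary distribution of an irreducible chain is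
given by `μ_s = (Σ_{g ∈ G(S∖{s})} p(g)) / (Σ_{y ∈ S} Σ_{g ∈ G(S∖{y})} p(g))`. -/
theorem stationary_eq_graph_ratio
    (hcard : 2 ≤ Fintype.card S)
    (q : Matrix S S ℝ) (hq : IsTransition q) (hqirr : IsIrreducible q)
    (μ : S → ℝ) (hμ : IsStationary q μ) (s : S) :
    μ s = (∑ g ∈ Gset (({s} : Finset S)ᶜ), wt q (({s} : Finset S)ᶜ) g) /
        ∑ y : S, ∑ g ∈ Gset (({y} : Finset S)ᶜ), wt q (({y} : Finset S)ᶜ) g := by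
  change μ s = rootedWeight q s / ∑ y, rootedWeight q y
  have hZ : 0 < ∑ y, rootedWeight q y :=
    Finset.sum_pos (fun y _ => rootedWeight_pos hq hqirr y) ⟨s, Finset.mem_univ s⟩
  rw [eq_div_iff hZ.ne', mul_comm]
  exact (hμ.eq_sum_mul hq hqirr (sum_rootedWeight_mul q hq) s).symm

end PerturbedMC
end
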